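/- Let k be a field of characteristic not two. A three-dimensional simple Lie algebra over k is split (i.e., isomorphic to sl(2,k)) if and only if its Killing form is isotropic. -/

import Mathlib

theorem aux_mem_sl {k : Type*} [Field k] (A : Matrix (Fin 2) (Fin 2) k) :
    A ∈ LieAlgebra.SpecialLinear.sl (Fin 2) k ↔ A.trace = 0 := Iff.rfl

theorem aux_cube {R : Type*} [Ring R] (E : R) (hE : E * E = 0) (X : R) :
    ⁅E, ⁅E, ⁅E, X⁆⁆⁆ = 0 := by
  have h : ∀ Y, E * (E * Y) = 0 := fun Y => by rw [← mul_assoc, hE, zero_mul]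
  simp [Ring.lie_def, mul_sub, sub_mul, mul_assoc, hE, h]

theorem aux_basis (k : Type*) [Field k] (L : Type*) [AddCommGroup L] [Module k L]
    [Module.Finite k L] (hdim : Module.finrank k L = 3) (v y : L) (hv : v ≠ 0)
    (hy : ∀ a : k, y ≠ a • v) : ∃ b : Module.Basis (Fin 3) k L, b 0 = v ∧ b 1 = y := by
  have hli : LinearIndependent k ![v, y] := by
    rw [LinearIndependent.pair_iff]
    intro s t h
    have ht : t = 0 := by
      by_contra ht
      apply hy (-(t⁻¹ * s))
      have h1 : t • y = -(s • v) := by rw [eq_neg_iff_add_eq_zero, add_comm]; exact h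
      rw [← inv_smul_smul₀ ht y, h1, smul_neg, smul_smul, neg_smul]
    subst ht
    simp [hv] at h
    exact ⟨h, rfl⟩
  obtain ⟨z, hz⟩ := exists_linearIndependent_snoc_of_lt_finrank hli (by omega)
  refine ⟨basisOfLinearIndependentOfCardEqFinrank hz (by simp [hdim]), ?_, ?_⟩
  · simp
  · simp

theorem aux_span (k : Type*) [Field k] (L : Type*) [LieRing L] [LieAlgebra k L]
    [LieAlgebra.IsSimple k L] (W : Submodule k L) (hW : ∀ x y : L, ⁅x, y⁆ ∈ W) : W = ⊤ := by
  let I : LieIdeal k L := { W with lie_mem := fun {x m} _ => hW x m }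
  have h := LieAlgebra.IsSimple.eq_bot_or_eq_top (R := k) I
  rcases h with h | h
  · exfalso
    apply LieAlgebra.IsSimple.non_abelian k (L := L)
    constructor
    intro x y
    have : ⁅x, y⁆ ∈ I := hW x y
    rw [h] at this
    simpa using this
  · have : (I : Submodule k L) = ⊤ := by rw [h]; rfl
    exact this

theorem aux_trace (k : Type*) [Field k] (L : Type*) [LieRing L] [LieAlgebra k L]
    [LieAlgebra.IsSimple k L] (x : L) : LinearMap.trace k L (LieAlgebra.ad k L x) = 0 := by
  have h := aux_span k L (LinearMap.ker ((LinearMap.trace k L).comp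
    (LieAlgebra.ad k L : L →ₗ[k] Module.End k L))) (by
      intro x y
      simp)
  have hx : x ∈ (⊤ : Submodule k L) := trivial
  rw [← h] at hx
  simpa using hx

theorem aux_cent (k : Type*) [Field k] (L : Type*) [LieRing L] [LieAlgebra k L]
    [Module.Finite k L] (hdim : Module.finrank k L = 3) [LieAlgebra.IsSimple k L]
    (v y : L) (hv : v ≠ 0) (h : ⁅v, y⁆ = 0) : ∃ a : k, y = a • v := by
  by_contra! hy
  obtain ⟨b, rfl, rfl⟩ := aux_basis k L hdim v y hv hy
  have h' : ⁅b 1, b 0⁆ = 0 := by rw [← lie_skew, h, neg_zero]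
  have ht := aux_span k L (Submodule.span k (Set.range ![⁅b 0, b 2⁆, ⁅b 1, b 2⁆])) (by
    intro x y
    have h02 : ⁅b 0, b 2⁆ ∈ Submodule.span k (Set.range ![⁅b 0, b 2⁆, ⁅b 1, b 2⁆]) :=
      Submodule.subset_span ⟨0, rfl⟩
    have h12 : ⁅b 1, b 2⁆ ∈ Submodule.span k (Set.range ![⁅b 0, b 2⁆, ⁅b 1, b 2⁆]) :=
      Submodule.subset_span ⟨1, rfl⟩
    have h20 := neg_mem h02
    have h21 := neg_mem h12
    rw [lie_skew] at h20 h21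
    rw [← b.sum_repr x, ← b.sum_repr y]
    simp only [Fin.sum_univ_three, add_lie, lie_add, smul_lie, lie_smul, h, h', lie_self,
      smul_zero, add_zero, zero_add]
    repeat' first | apply add_mem | apply Submodule.smul_mem | assumption)
  have h2 := finrank_range_le_card (R := k) ![⁅b 0, b 2⁆, ⁅b 1, b 2⁆]
  rw [Set.finrank, ht, finrank_top, hdim] at h2
  simp at h2

theorem aux_sq (k : Type*) [Field k] (hchar : (2 : k) ≠ 0)
    (L : Type*) [LieRing L] [LieAlgebra k L] [Module.Finite k L]
    (hdim : Module.finrank k L = 3) [LieAlgebra.IsSimple k L] (v : L) (hv : v ≠ 0)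
    (hk : killingForm k L v v = 0) : ∃ (y : L) (c : k), c ≠ 0 ∧ ⁅v, ⁅v, y⁆⁆ = c • v := by
  obtain ⟨y, hy⟩ : ∃ y : L, ∀ a : k, y ≠ a • v := by
    by_contra! hcon
    have := finrank_le_one (R := k) v (fun w => by
      obtain ⟨a, ha⟩ := hcon w
      exact ⟨a, ha.symm⟩)
    omega
  obtain ⟨b, rfl, rfl⟩ := aux_basis k L hdim v y hv hy
  have htr := aux_trace k L (b 0)
  rw [killingForm_apply_apply] at hk
  obtain ⟨p, q, r, h1⟩ : ∃ p q r : k, ⁅b 0, b 1⁆ = p • b 0 + q • b 1 + r • b 2 :=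
    ⟨_, _, _, by rw [← Fin.sum_univ_three (fun i => b.repr ⁅b 0, b 1⁆ i • b i), b.sum_repr]⟩
  obtain ⟨p', q', r', h2⟩ : ∃ p q r : k, ⁅b 0, b 2⁆ = p • b 0 + q • b 1 + r • b 2 :=
    ⟨_, _, _, by rw [← Fin.sum_univ_three (fun i => b.repr ⁅b 0, b 2⁆ i • b i), b.sum_repr]⟩
  rw [LinearMap.trace_eq_matrix_trace k b, Matrix.trace_fin_three] at htr hk
  simp [LinearMap.toMatrix_apply, h1, h2] at htr hk
  have e1 : r' = -q := by linear_combination htr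
  subst e1
  have e2 : q * q + r * q' = 0 := by
    apply mul_left_cancel₀ hchar
    linear_combination hk
  have s1 : ⁅b 0, ⁅b 0, b 1⁆⁆ = (q * p + r * p') • b 0 := by
    have : r * q' = - (q * q) := by linear_combination e2
    rw [h1]
    simp only [lie_add, lie_smul, lie_self, h1, h2]
    linear_combination (norm := module) e2 • b 1
  have s2 : ⁅b 0, ⁅b 0, b 2⁆⁆ = (q' * p - q * p') • b 0 := by
    rw [h2]
    simp only [lie_add, lie_smul, lie_self, h1, h2]
    linear_combination (norm := module) e2 • b 2
  by_cases c1 : q * p + r * p' = 0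
  swap
  · exact ⟨_, _, c1, s1⟩
  by_cases c2 : q' * p - q * p' = 0
  swap
  · exact ⟨_, _, c2, s2⟩
  exfalso
  have li : ∀ x y z : k, x • b 0 + y • b 1 + z • b 2 = 0 → x = 0 ∧ y = 0 ∧ z = 0 := by
    intro x y z h
    have := Fintype.linearIndependent_iff.1 b.linearIndependent ![x, y, z]
      (by simpa [Fin.sum_univ_three] using h)
    exact ⟨this 0, this 1, this 2⟩
  rw [c1, zero_smul] at s1
  rw [c2, zero_smul] at s2
  have key : ∀ y z : k, ⁅b 0, y • b 1 + z • b 2⁆ = 0 → y = 0 ∧ z = 0 := by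
    intro y z h
    obtain ⟨a, ha⟩ := aux_cent k L hdim _ _ hv h
    have := li (-a) y z (by rw [add_assoc, ha]; simp)
    exact this.2
  obtain ⟨a, ha⟩ := aux_cent k L hdim _ _ hv s1
  obtain ⟨a', ha'⟩ := aux_cent k L hdim _ _ hv s2
  have k1 := key a' (-a) (by
    rw [lie_add, lie_smul, lie_smul, ha, ha', smul_smul, smul_smul, ← add_smul]
    simp [mul_comm])
  have k2 := key 1 0 (by simp [ha, neg_eq_zero.1 k1.2])
  exact one_ne_zero k2.1

theorem aux_triple (k : Type*) [Field k] (hchar : (2 : k) ≠ 0)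
    (L : Type*) [LieRing L] [LieAlgebra k L] [Module.Finite k L]
    (hdim : Module.finrank k L = 3) [LieAlgebra.IsSimple k L] (v : L) (hv : v ≠ 0)
    (hk : killingForm k L v v = 0) : ∃ (b : Module.Basis (Fin 3) k L),
      ⁅b 0, b 2⁆ = b 1 ∧ ⁅b 1, b 0⁆ = (2 : k) • b 0 ∧ ⁅b 1, b 2⁆ = (-2 : k) • b 2 := by
  obtain ⟨y₀, c, hc, h₀⟩ := aux_sq k hchar L hdim v hv hk
  obtain ⟨y, hy⟩ : ∃ y : L, ⁅v, ⁅v, y⁆⁆ = (-2 : k) • v :=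
    ⟨(-2 * c⁻¹) • y₀, by rw [lie_smul, lie_smul, h₀, smul_smul]; congr 1; field_simp⟩
  have ind : ∀ y : L, ⁅v, ⁅v, y⁆⁆ = (-2 : k) • v → LinearIndependent k ![v, ⁅v, y⁆, y] := by
    intro y hy
    rw [Fintype.linearIndependent_iff]
    intro g hg
    simp [Fin.sum_univ_three] at hg
    have g1 := congrArg (fun w => ⁅v, w⁆) hg
    simp [hy] at g1
    have g2 := congrArg (fun w => ⁅v, w⁆) g1
    simp [hy, hchar, hv] at g2
    simp [g2, hchar, hv] at g1
    simp [g1, g2, hv] at hg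
    intro i
    fin_cases i <;> assumption
  let b := basisOfLinearIndependentOfCardEqFinrank (ind y hy) (by simp [hdim])
  have b0 : b 0 = v := by simp [b]
  have b1 : b 1 = ⁅v, y⁆ := by simp [b]
  have b2 : b 2 = y := by simp [b]
  obtain ⟨p, q, r, h1⟩ : ∃ p q r : k, ⁅⁅v, y⁆, y⁆ = p • v + q • ⁅v, y⁆ + r • y :=
    ⟨b.repr ⁅⁅v, y⁆, y⁆ 0, b.repr ⁅⁅v, y⁆, y⁆ 1, b.repr ⁅⁅v, y⁆, y⁆ 2, by
      conv_lhs => rw [← b.sum_repr ⁅⁅v, y⁆, y⁆]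
      rw [Fin.sum_univ_three, b0, b1, b2]⟩
  have hy' : ⁅⁅v, y⁆, v⁆ = (2 : k) • v := by
    rw [← lie_skew, hy, neg_smul, neg_neg]
  have jac := leibniz_lie v ⁅v, y⁆ y
  rw [h1, hy, lie_self] at jac
  simp only [lie_add, lie_smul, lie_self, hy, smul_lie, add_zero, smul_zero, zero_add] at jac
  have e := Fintype.linearIndependent_iff.1 (ind y hy) ![-2 * q, r + 2, 0] (by
    simp [Fin.sum_univ_three]
    linear_combination (norm := module) jac)
  have hq : q = 0 := by simpa [hchar] using e 0
  have hr : r = -2 := by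
    have : r + 2 = 0 := e 1
    linear_combination this
  subst hq hr
  let y' := y + (-p / 4) • v
  have h4 : (4 : k) ≠ 0 := by
    have : (4 : k) = 2 * 2 := by norm_num
    rw [this]; exact mul_ne_zero hchar hchar
  have hvy : ⁅v, y'⁆ = ⁅v, y⁆ := by simp [y']
  refine ⟨basisOfLinearIndependentOfCardEqFinrank (ind y' (by rw [hvy, hy])) (by simp [hdim]),
    ?_, ?_, ?_⟩
  · simp
  · simp [hvy, hy']
  · simp only [coe_basisOfLinearIndependentOfCardEqFinrank]
    change ⁅⁅v, y'⁆, y'⁆ = (-2 : k) • y'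
    rw [hvy]
    simp only [y', lie_add, lie_smul, h1, hy']
    have : (-p / 4) * 4 = -p := by field_simp
    linear_combination (norm := module) this • v

theorem aux_equiv (k : Type*) [Field k] (L : Type*) [LieRing L] [LieAlgebra k L]
    (b : Module.Basis (Fin 3) k L) (h1 : ⁅b 0, b 2⁆ = b 1) (h2 : ⁅b 1, b 0⁆ = (2 : k) • b 0)
    (h3 : ⁅b 1, b 2⁆ = (-2 : k) • b 2) :
    Nonempty (L ≃ₗ⁅k⁆ LieAlgebra.SpecialLinear.sl (Fin 2) k) := by
  have tr : ∀ A : LieAlgebra.SpecialLinear.sl (Fin 2) k, A.1 1 1 = - A.1 0 0 := by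
    intro A
    have := (aux_mem_sl A.1).1 A.2
    rw [Matrix.trace_fin_two] at this
    linear_combination this
  have h1' : ⁅b 2, b 0⁆ = - b 1 := by rw [← lie_skew, h1]
  have h2' : ⁅b 0, b 1⁆ = (-2 : k) • b 0 := by rw [← lie_skew, h2, neg_smul]
  have h3' : ⁅b 2, b 1⁆ = (2 : k) • b 2 := by rw [← lie_skew, h3, neg_smul, neg_neg]
  let f : LieAlgebra.SpecialLinear.sl (Fin 2) k →ₗ⁅k⁆ L :=
    { toFun := fun A => A.1 0 1 • b 0 + A.1 0 0 • b 1 + A.1 1 0 • b 2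
      map_add' := by
        intro A B
        change (A.1 0 1 + B.1 0 1) • b 0 + (A.1 0 0 + B.1 0 0) • b 1 + (A.1 1 0 + B.1 1 0) • b 2 = _
        module
      map_smul' := by
        intro c A
        simp [smul_smul]
      map_lie' := by
        intro A B
        have tA := tr A
        have tB := tr B
        simp only [LieSubalgebra.coe_bracket, Ring.lie_def, Matrix.sub_apply, Matrix.mul_apply,
          Fin.sum_univ_two, add_lie, lie_add, smul_lie, lie_smul, lie_self, h1, h2, h3, h1', h2',
          h3', tA, tB]
        module }
  have bij : Function.Bijective f := by
    constructor
    · rw [injective_iff_map_eq_zero]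
      intro A hA
      have := Fintype.linearIndependent_iff.1 b.linearIndependent ![A.1 0 1, A.1 0 0, A.1 1 0]
        (by simp [Fin.sum_univ_three]; exact hA)
      have a0 : A.1 0 1 = 0 := this 0
      have a1 : A.1 0 0 = 0 := this 1
      have a2 : A.1 1 0 = 0 := this 2
      have a3 := tr A
      rw [a1, neg_zero] at a3
      ext i j
      fin_cases i <;> fin_cases j <;> assumption
    · intro x
      refine ⟨⟨!![b.repr x 1, b.repr x 0; b.repr x 2, -b.repr x 1], ?_⟩, ?_⟩
      · rw [aux_mem_sl, Matrix.trace_fin_two]; simp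
      · change b.repr x 0 • b 0 + b.repr x 1 • b 1 + b.repr x 2 • b 2 = x
        rw [← Fin.sum_univ_three (fun i => b.repr x i • b i), b.sum_repr]
  exact ⟨(LieEquiv.ofBijective f bij).symm⟩

/-- A three-dimensional simple Lie algebra over `k` (char ≠ 2) is split (isomorphic to
`sl(2,k)`) if and only if its Killing form is isotropic. -/
theorem split_iff_killing_isotropic (k : Type*) [Field k] (hchar : (2 : k) ≠ 0)
    (L : Type*) [LieRing L] [LieAlgebra k L] [Module.Finite k L]
    (hdim : Module.finrank k L = 3) [LieAlgebra.IsSimple k L] :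
    Nonempty (L ≃ₗ⁅k⁆ LieAlgebra.SpecialLinear.sl (Fin 2) k) ↔
      ∃ v : L, v ≠ 0 ∧ killingForm k L v v = 0 := by
  constructor
  · rintro ⟨φ⟩
    let e : LieAlgebra.SpecialLinear.sl (Fin 2) k :=
      ⟨!![0, 1; 0, 0], by rw [aux_mem_sl, Matrix.trace_fin_two]; simp⟩
    have he : e ≠ 0 := by
      intro h
      have := congrFun (congrFun (congrArg Subtype.val h) 0) 1
      simp [e] at this
    have hee : ∀ A : LieAlgebra.SpecialLinear.sl (Fin 2) k, ⁅e, ⁅e, ⁅e, A⁆⁆⁆ = 0 := by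
      intro A
      apply Subtype.ext
      have hE : (!![0, 1; 0, 0] : Matrix (Fin 2) (Fin 2) k) * !![0, 1; 0, 0] = 0 := by
        ext i j
        fin_cases i <;> fin_cases j <;> simp
      exact aux_cube _ hE A.1
    refine ⟨φ.symm e, ?_, ?_⟩
    · intro h
      apply he
      have := congrArg φ h
      simpa using this
    · rw [killingForm_apply_apply]
      apply IsNilpotent.eq_zero (R := k)
      apply LinearMap.isNilpotent_trace_of_isNilpotent
      refine ⟨2, ?_⟩
      ext x
      have : ⁅φ.symm e, ⁅φ.symm e, ⁅φ.symm e, x⁆⁆⁆ = 0 := by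
        apply φ.injective
        simp [hee]
      simp [pow_two, this]
  · rintro ⟨v, hv, hk⟩
    obtain ⟨b, h1, h2, h3⟩ := aux_triple k hchar L hdim v hv hk
    exact aux_equiv k L b h1 h2 h3
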